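/- arXiv:2106.05675 — 3 statements merged into one kernel-verified Lean document; each statement's English description precedes it below -/
import Mathlib

section
/- Let V be a real vector space with finrank V = 2n (n ≥ 1), ω a nondegenerate alternating bilinear form on V, L ≤ V a Lagrangian subspace and Y ≤ V a hyperplane with L ⊔ Y = ⊤ (transversality). Then the slice K = L ⊓ Y satisfies finrank K = n − 1 and K ⊓ Y^⊥ = ⊥; in particular the characteristic (Reeb) direction of Y is not tangent to the slice. -/
/-- The `ω`-orthogonal of a subspace `W`: all `v` with `ω v w = 0` for every `w ∈ W`. -/
def orth {V : Type*} [AddCommGroup V] [Module ℝ V]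
    (ω : V →ₗ[ℝ] V →ₗ[ℝ] ℝ) (W : Submodule ℝ V) : Submodule ℝ V where
  carrier := {v | ∀ w ∈ W, ω v w = 0}
  zero_mem' := by intro w hw; simp
  add_mem' := by intro a b ha hb w hw; simp [ha w hw, hb w hw]
  smul_mem' := by intro c a ha w hw; simp [ha w hw]

/-- For an alternating form, `orth` is the bilinear-form orthogonal complement. -/
theorem orth_eq_orthogonal {V : Type*} [AddCommGroup V] [Module ℝ V]
    {ω : V →ₗ[ℝ] V →ₗ[ℝ] ℝ} (halt : ω.IsAlt) (W : Submodule ℝ V) :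
    orth ω W = LinearMap.BilinForm.orthogonal ω W := by
  ext v
  exact forall₂_congr fun w _ => ⟨halt.isRefl v w, halt.isRefl w v⟩

/-- A Lagrangian subspace has half the dimension of the ambient space. -/
theorem two_mul_finrank_of_orth_eq_self {V : Type*} [AddCommGroup V] [Module ℝ V]
    [FiniteDimensional ℝ V] {ω : V →ₗ[ℝ] V →ₗ[ℝ] ℝ} (halt : ω.IsAlt)
    (hnd : ω.Nondegenerate) {L : Submodule ℝ V} (hL : orth ω L = L) :
    2 * Module.finrank ℝ L = Module.finrank ℝ V := by
  have h := LinearMap.BilinForm.finrank_orthogonal hnd L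
  rw [← orth_eq_orthogonal halt, hL] at h
  have := L.finrank_le
  omega

/-- A vector orthogonal to two subspaces spanning the whole space vanishes. -/
theorem orth_inf_orth_eq_bot {V : Type*} [AddCommGroup V] [Module ℝ V]
    {ω : V →ₗ[ℝ] V →ₗ[ℝ] ℝ} (hnd : ω.SeparatingLeft) {W₁ W₂ : Submodule ℝ V}
    (h : W₁ ⊔ W₂ = ⊤) : orth ω W₁ ⊓ orth ω W₂ = ⊥ := by
  rw [Submodule.eq_bot_iff]
  rintro v ⟨hv₁, hv₂⟩
  refine hnd v fun w => ?_
  obtain ⟨a, ha, b, hb, rfl⟩ := Submodule.mem_sup.mp (h ▸ Submodule.mem_top : w ∈ W₁ ⊔ W₂)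
  rw [map_add, hv₁ a ha, hv₂ b hb, add_zero]

/-- If a Lagrangian `L` is transverse to a hyperplane `Y`, then the slice
`K = L ⊓ Y` has dimension `n − 1` and meets the characteristic line `Y^⊥` trivially. -/
theorem stmt2 {V : Type*} [AddCommGroup V] [Module ℝ V] [FiniteDimensional ℝ V]
    (n : ℕ) (hn : 1 ≤ n) (hV : Module.finrank ℝ V = 2 * n)
    (ω : V →ₗ[ℝ] V →ₗ[ℝ] ℝ)
    (halt : ∀ v, ω v v = 0)
    (hnd : ∀ v, (∀ w, ω v w = 0) → v = 0)
    (L : Submodule ℝ V) (hL : orth ω L = L)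
    (Y : Submodule ℝ V) (hY : Module.finrank ℝ Y = 2 * n - 1)
    (hT : L ⊔ Y = ⊤) :
    Module.finrank ℝ ↥(L ⊓ Y) = n - 1 ∧ (L ⊓ Y) ⊓ orth ω Y = ⊥ := by
  have hsep : ω.SeparatingLeft := hnd
  have hrefl : ω.IsRefl := LinearMap.IsAlt.isRefl halt
  constructor
  · have hdim := two_mul_finrank_of_orth_eq_self halt
      (hrefl.nondegenerate_iff_separatingLeft.mpr hsep) hL
    have hsum := Submodule.finrank_sup_add_finrank_inf_eq L Y
    rw [hT, finrank_top] at hsum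
    omega
  · rw [eq_bot_iff, ← orth_inf_orth_eq_bot hsep hT, hL]
    exact inf_le_inf_right _ inf_le_left
end

section
/- In the linear symplectization model (forward direction of the paper's Lemma characterizing Lagrangian slices, pointwise): if L ≤ ℝ × Y' is a Lagrangian subspace for Ω (L^⊥ = L) which is transverse to {0} × Y' (i.e. L ⊔ ({0} × Y') = ⊤), then the slice K = {u ∈ Y' : (0, u) ∈ L} satisfies β(u, v) = 0 for all u, v ∈ K (the pullback of dα vanishes on the slice) and K ⊓ span ℝ {R} = ⊥ (the Reeb vector is not tangent to the slice). -/
/-- The linear symplectization form on `ℝ × Y'`: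
`Ω((s,u),(t,v)) = s·α(v) − t·α(u) + β(u,v)`. -/
noncomputable def Omega {Y' : Type*} [AddCommGroup Y'] [Module ℝ Y']
    (α : Y' →ₗ[ℝ] ℝ) (β : Y' →ₗ[ℝ] Y' →ₗ[ℝ] ℝ) :
    (ℝ × Y') →ₗ[ℝ] (ℝ × Y') →ₗ[ℝ] ℝ :=
  LinearMap.mk₂ ℝ (fun p q => p.1 * α q.2 - q.1 * α p.2 + β p.2 q.2)
    (fun p p' q => by simp; ring)
    (fun c p q => by simp; ring)
    (fun p q q' => by simp; ring)
    (fun c p q => by simp; ring)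

theorem eq_zero_of_orth_eq_self {V : Type*} [AddCommGroup V] [Module ℝ V]
    {ω : V →ₗ[ℝ] V →ₗ[ℝ] ℝ} {L : Submodule ℝ V} (hL : orth ω L = L)
    {p q : V} (hp : p ∈ L) (hq : q ∈ L) : ω p q = 0 := by
  rw [← hL] at hp
  exact hp q hq

/-- If `L ≤ ℝ × Y'` is Lagrangian for `Ω` and transverse to `{0} × Y'`,
then the slice `K = {u : (0,u) ∈ L}` is `β`-isotropic and meets the Reeb line trivially. -/
theorem stmt8 {Y' : Type*} [AddCommGroup Y'] [Module ℝ Y'] [FiniteDimensional ℝ Y']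
    (n : ℕ) (hn : 1 ≤ n) (hY' : Module.finrank ℝ Y' = 2 * n - 1)
    (α : Y' →ₗ[ℝ] ℝ) (β : Y' →ₗ[ℝ] Y' →ₗ[ℝ] ℝ)
    (hβalt : ∀ v, β v v = 0)
    (hβnd : ∀ u ∈ LinearMap.ker α, (∀ v ∈ LinearMap.ker α, β u v = 0) → u = 0)
    (R : Y') (hR1 : α R = 1) (hR2 : ∀ v, β R v = 0)
    (L : Submodule ℝ (ℝ × Y'))
    (hLag : orth (Omega α β) L = L)
    (hT : L ⊔ (⊥ : Submodule ℝ ℝ).prod (⊤ : Submodule ℝ Y') = ⊤)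
    (K : Submodule ℝ Y') (hK : K = L.comap (LinearMap.inr ℝ ℝ Y')) :
    (∀ u ∈ K, ∀ v ∈ K, β u v = 0) ∧ K ⊓ Submodule.span ℝ {R} = ⊥ := by
  subst hK
  refine ⟨fun u hu v hv => ?_, ?_⟩
  · simpa [Omega] using eq_zero_of_orth_eq_self hLag hu hv
  · rw [Submodule.eq_bot_iff]
    rintro x ⟨hx, hxR⟩
    obtain ⟨c, rfl⟩ := Submodule.mem_span_singleton.mp hxR
    have hmem : ((1, 0) : ℝ × Y') ∈ L ⊔ (⊥ : Submodule ℝ ℝ).prod (⊤ : Submodule ℝ Y') :=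
      hT ▸ Submodule.mem_top
    obtain ⟨p, hp, q, hq, hpq⟩ := Submodule.mem_sup.mp hmem
    have hq0 : q.1 = 0 := hq.1
    have hp1 : p.1 = 1 := by simpa [hq0] using congrArg Prod.fst hpq
    have hc : c = 0 := by
      simpa [Omega, hp1, hR1, hR2] using eq_zero_of_orth_eq_self hLag hx hp
    simp [hc]
end

section
/- In the linear symplectization model (converse direction of the paper's Lemma characterizing Lagrangian slices, pointwise): if K ≤ Y' is a subspace with finrank K = n − 1 such that β(u, v) = 0 for all u, v ∈ K and K ⊓ span ℝ {R} = ⊥, then there exists a Lagrangian subspace L ≤ ℝ × Y' for Ω with L ⊔ ({0} × Y') = ⊤ and L ⊓ ({0} × Y') = {0} × K (the image of K under the inclusion u ↦ (0, u)). -/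
/-- The kernel of a bilinear form that is nondegenerate on the kernel of `α` lies on the line
spanned by the Reeb vector. -/
theorem mem_span_reeb_of_forall_eq_zero {Y' : Type*} [AddCommGroup Y'] [Module ℝ Y']
    {α : Y' →ₗ[ℝ] ℝ} {β : Y' →ₗ[ℝ] Y' →ₗ[ℝ] ℝ}
    (hβnd : ∀ u ∈ LinearMap.ker α, (∀ v ∈ LinearMap.ker α, β u v = 0) → u = 0)
    {R : Y'} (hR1 : α R = 1) (hR2 : ∀ v, β R v = 0) {u : Y'} (hu : ∀ v, β u v = 0) :
    u ∈ Submodule.span ℝ {R} := by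
  have h : u - α u • R = 0 :=
    hβnd _ (by simp [hR1]) fun v _ => by simp [hu, hR2]
  exact Submodule.mem_span_singleton.2 ⟨α u, (sub_eq_zero.1 h).symm⟩

/-- An injective linear map from `K` to the dual of a finite-dimensional space flips to a
surjective map onto the dual of `K`. -/
theorem flip_surjective_of_injective {K Y' : Type*} [AddCommGroup Y'] [Module ℝ Y']
    [FiniteDimensional ℝ Y'] [AddCommGroup K] [Module ℝ K]
    {g : K →ₗ[ℝ] Y' →ₗ[ℝ] ℝ} (hg : Function.Injective g) : Function.Surjective g.flip := by
  intro φ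
  obtain ⟨ψ, rfl⟩ := LinearMap.dualMap_surjective_of_injective hg φ
  obtain ⟨w, rfl⟩ := (Module.evalEquiv ℝ Y').surjective ψ
  exact ⟨w, by ext k; simp⟩

/-- Every `(n−1)`-dimensional `β`-isotropic subspace `K ≤ Y'` meeting the
Reeb line trivially arises as the transverse intersection of an `Ω`-Lagrangian
`L ≤ ℝ × Y'` with the hyperplane `{0} × Y'`. -/
theorem stmt9 {Y' : Type*} [AddCommGroup Y'] [Module ℝ Y'] [FiniteDimensional ℝ Y']
    (n : ℕ) (hn : 1 ≤ n) (hY' : Module.finrank ℝ Y' = 2 * n - 1)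
    (α : Y' →ₗ[ℝ] ℝ) (β : Y' →ₗ[ℝ] Y' →ₗ[ℝ] ℝ)
    (hβalt : ∀ v, β v v = 0)
    (hβnd : ∀ u ∈ LinearMap.ker α, (∀ v ∈ LinearMap.ker α, β u v = 0) → u = 0)
    (R : Y') (hR1 : α R = 1) (hR2 : ∀ v, β R v = 0)
    (K : Submodule ℝ Y')
    (hK : Module.finrank ℝ K = n - 1)
    (hiso : ∀ u ∈ K, ∀ v ∈ K, β u v = 0)
    (hchar : K ⊓ Submodule.span ℝ {R} = ⊥) :
    ∃ L : Submodule ℝ (ℝ × Y'),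
      orth (Omega α β) L = L ∧
      L ⊔ (⊥ : Submodule ℝ ℝ).prod (⊤ : Submodule ℝ Y') = ⊤ ∧
      L ⊓ (⊥ : Submodule ℝ ℝ).prod (⊤ : Submodule ℝ Y') =
        K.map (LinearMap.inr ℝ ℝ Y') := by
  have hskew : ∀ u v, β u v = -β v u := fun u v => by
    have h := hβalt (u + v)
    simp only [map_add, LinearMap.add_apply, hβalt] at h
    linarith
  let g : K →ₗ[ℝ] Y' →ₗ[ℝ] ℝ := β.comp K.subtype
  have hg : Function.Injective g := by
    rw [injective_iff_map_eq_zero]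
    intro k hk
    have h : (k : Y') ∈ K ⊓ Submodule.span ℝ {R} :=
      ⟨k.2, mem_span_reeb_of_forall_eq_zero hβnd hR1 hR2 fun v => LinearMap.congr_fun hk v⟩
    rw [hchar] at h
    exact Subtype.ext h
  have hsurj := flip_surjective_of_injective hg
  obtain ⟨w, hw⟩ := hsurj (α.comp K.subtype)
  have hw : ∀ k ∈ K, β k w = α k := fun k hk => LinearMap.congr_fun hw ⟨k, hk⟩
  have hR0 : R ≠ 0 := by
    rintro rfl
    simp at hR1
  have hker : K ⊔ Submodule.span ℝ {R} = LinearMap.ker g.flip := by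
    apply Submodule.eq_of_le_of_finrank_eq
    · refine sup_le (fun u hu => ?_) ?_
      · ext k
        exact hiso k k.2 u hu
      · rw [Submodule.span_singleton_le_iff_mem]
        ext k
        change β k R = 0
        rw [hskew, hR2, neg_zero]
    · have h1 := Submodule.finrank_sup_add_finrank_inf_eq K (Submodule.span ℝ {R})
      rw [hchar, finrank_bot, finrank_span_singleton hR0, hK] at h1
      have h2 := LinearMap.finrank_range_add_finrank_ker g.flip
      have h3 : Module.finrank ℝ (K →ₗ[ℝ] ℝ) = Module.finrank ℝ K :=
        Subspace.dual_finrank_eq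
      rw [LinearMap.range_eq_top.2 hsurj, finrank_top, h3, hK, hY'] at h2
      omega
  let L : Submodule ℝ (ℝ × Y') :=
    K.comap (LinearMap.snd ℝ ℝ Y' - (LinearMap.fst ℝ ℝ Y').smulRight w)
  have hL : ∀ p : ℝ × Y', p ∈ L ↔ p.2 - p.1 • w ∈ K := fun _ => Iff.rfl
  have hΩ : ∀ p q, Omega α β p q = p.1 * α q.2 - q.1 * α p.2 + β p.2 q.2 := fun _ _ => rfl
  refine ⟨L, le_antisymm ?_ ?_, ?_, ?_⟩
  · rintro ⟨s, u⟩ hu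
    have hu : ∀ q ∈ L, Omega α β (s, u) q = 0 := hu
    have hmem : u - s • w ∈ LinearMap.ker g.flip := by
      ext k
      change β k (u - s • w) = 0
      have h := hu (0, k) (by simp [hL])
      rw [hΩ] at h
      rw [map_sub, map_smul, hw k k.2, hskew, smul_eq_mul]
      simp only [zero_mul, sub_zero] at h
      linarith
    rw [← hker, Submodule.mem_sup] at hmem
    obtain ⟨k, hk, r, hr, hkr⟩ := hmem
    obtain ⟨c, rfl⟩ := Submodule.mem_span_singleton.1 hr
    obtain rfl : u = k + c • R + s • w := by rw [hkr]; abel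
    have h := hu (1, w) (by simp [hL])
    simp only [hΩ, map_add, map_smul, LinearMap.add_apply, LinearMap.smul_apply, hw k hk, hR1,
      hR2, hβalt, smul_eq_mul] at h
    have hc : c = 0 := by linarith
    rw [hL]
    simpa [hc] using hk
  · rintro ⟨s, u⟩ hu ⟨t, v⟩ hv
    rw [hL] at hu hv
    obtain ⟨k, hk, rfl⟩ : ∃ k ∈ K, u = k + s • w := ⟨_, hu, by simp⟩
    obtain ⟨l, hl, rfl⟩ : ∃ l ∈ K, v = l + t • w := ⟨_, hv, by simp⟩
    simp only [hΩ, map_add, map_smul, LinearMap.add_apply, LinearMap.smul_apply, hw k hk,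
      hskew w l, hw l hl, hiso k hk l hl, hβalt, smul_eq_mul]
    ring
  · rw [eq_top_iff]
    rintro ⟨s, u⟩ -
    exact Submodule.mem_sup.2 ⟨(s, s • w), by simp [hL], (0, u - s • w), by simp, by simp⟩
  · ext ⟨s, u⟩
    simp only [Submodule.mem_inf, hL, Submodule.mem_prod, Submodule.mem_bot, Submodule.mem_top,
      and_true, Submodule.mem_map, LinearMap.inr_apply, Prod.mk.injEq]
    constructor
    · rintro ⟨h, rfl⟩
      exact ⟨u, by simpa using h, rfl, rfl⟩
    · rintro ⟨k, hk, rfl, rfl⟩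
      exact ⟨by simpa using hk, rfl⟩
end
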